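/- (Strong local nondeterminism in spherical integral form.) For every a > 0 there exist constants C > 0 and r₀ > 0 such that for every integer n ≥ 1, all points (t, x), (t¹, x¹), …, (tⁿ, xⁿ) ∈ [a, ∞) × ℝ^N with max_{1≤j≤n}(|t − t^j| + |x − x^j|) ≤ r₀, and all real numbers a₁, …, aₙ, one has ∫_ℝ ∫_{ℝ^N} |𝒢_{t,x}(τ, ξ) − Σ_{j=1}^n a_j 𝒢_{t^j,x^j}(τ, ξ)|² |τ|^{1−2H} h_β(ξ) dξ dτ ≥ C ∫_{S^{N−1}} min_{1≤j≤n} |(t − t^j) + ⟨x − x^j, w⟩|^{2α} dσ(w). (Equivalently, Var(u₁(t,x) | u₁(t¹,x¹), …, u₁(tⁿ,xⁿ)) is bounded below by the spherical integral on the right.) -/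

import Mathlib

open MeasureTheory Set
open scoped ENNReal

/-- The time–space Fourier transform `𝒢_{t,x}(τ, ξ)` of the wave kernel
`g_{t,x}(s, y) = G(t − s, x − y) 1_{[0,t]}(s)`. -/
noncomputable def Gker (N : ℕ) (t : ℝ) (x : EuclideanSpace ℝ (Fin N)) (τ : ℝ)
    (ξ : EuclideanSpace ℝ (Fin N)) : ℂ :=
  (Complex.exp (-Complex.I * ((inner ℝ x ξ : ℝ) : ℂ)) / (2 * (‖ξ‖ : ℂ))) *
    ((Complex.exp (-Complex.I * (t : ℂ) * (τ : ℂ)) -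
        Complex.exp (Complex.I * (t : ℂ) * (‖ξ‖ : ℂ))) / ((τ : ℂ) + (‖ξ‖ : ℂ)) -
      (Complex.exp (-Complex.I * (t : ℂ) * (τ : ℂ)) -
        Complex.exp (-Complex.I * (t : ℂ) * (‖ξ‖ : ℂ))) / ((τ : ℂ) - (‖ξ‖ : ℂ)))

/-- The spectral integral `∫_ℝ ∫_{ℝ^N} |f(τ,ξ)|² |τ|^{1−2H} h_β(ξ) dξ dτ`, which (up to a
positive constant) gives the variance of the corresponding linear functional of the solution. -/
noncomputable def specInt (N : ℕ) (H : ℝ) (hfun : EuclideanSpace ℝ (Fin N) → ℝ)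
    (f : ℝ → EuclideanSpace ℝ (Fin N) → ℂ) : ℝ≥0∞ :=
  ∫⁻ τ : ℝ, ∫⁻ ξ : EuclideanSpace ℝ (Fin N),
    ENNReal.ofReal (‖f τ ξ‖ ^ 2 * |τ| ^ (1 - 2 * H) * hfun ξ)

/-- The surface measure `σ` on the unit sphere `S^{N−1} ⊂ ℝ^N`. -/
noncomputable def sphMeasure (N : ℕ) :
    Measure (Metric.sphere (0 : EuclideanSpace ℝ (Fin N)) 1) :=
  (volume : Measure (EuclideanSpace ℝ (Fin N))).toSphere

open Complex in
open scoped FourierTransform SchwartzMap in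
theorem aux_bump : ∃ ψ : 𝓢(ℝ, ℂ), ψ 0 = 1 ∧ (∀ x : ℝ, 1 ≤ 2 * Real.pi * |x| → ψ x = 0) ∧
    (∀ x : ℝ, 1 < 2 * Real.pi * |x| → SchwartzMap.derivCLM ℂ ℂ ψ x = 0) := by
  have hpi := Real.pi_pos
  let b : ContDiffBump (0 : ℝ) := ⟨1 / (4 * Real.pi), 1 / (2 * Real.pi), by positivity, by
    rw [div_lt_div_iff₀ (by positivity) (by positivity)]; linarith⟩
  have hc : HasCompactSupport (fun x : ℝ => ((b x : ℝ) : ℂ)) :=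
    b.hasCompactSupport.comp_left (g := fun x : ℝ => (x : ℂ)) (by simp)
  have hs : ContDiff ℝ (⊤ : ℕ∞) (fun x : ℝ => ((b x : ℝ) : ℂ)) :=
    Complex.ofRealCLM.contDiff.comp b.contDiff
  have hz : ∀ x : ℝ, 1 ≤ 2 * Real.pi * |x| → ((b x : ℝ) : ℂ) = 0 := by
    intro x hx
    have : b x = 0 := by
      apply b.zero_of_le_dist
      rw [Real.dist_eq, sub_zero]
      change 1 / (2 * Real.pi) ≤ |x|
      rw [div_le_iff₀ (by positivity)]; linarith
    simp [this]
  refine ⟨hc.toSchwartzMap hs, ?_, ?_, ?_⟩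
  · change ((b 0 : ℝ) : ℂ) = 1
    rw [b.one_of_mem_closedBall]
    · simp
    · simp [b.rIn_pos.le]
  · intro x hx
    exact hz x hx
  · intro x hx
    rw [SchwartzMap.derivCLM_apply]
    have : (⇑(hc.toSchwartzMap hs)) =ᶠ[nhds x] fun _ => (0 : ℂ) := by
      have ho : IsOpen {y : ℝ | 1 < 2 * Real.pi * |y|} :=
        isOpen_lt continuous_const (by fun_prop)
      filter_upwards [ho.mem_nhds hx] with y hy
      exact hz y (le_of_lt hy)
    rw [this.deriv_eq]; simp

open Complex in
open scoped FourierTransform SchwartzMap in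
theorem aux_inv (χ : 𝓢(ℝ, ℂ)) (r : ℝ) (hr : 0 < r) (y : ℝ) :
    ∫ l : ℝ, 𝓕 (χ : ℝ → ℂ) (r * l) * exp (I * y * l) = (r⁻¹ : ℝ) * χ (y / (2 * Real.pi * r)) := by
  have h1 : 𝓕⁻ (𝓕 (χ : ℝ → ℂ)) = χ := by
    rw [← SchwartzMap.fourier_coe, ← SchwartzMap.fourierInv_coe]
    simp
  have h2 := congrFun h1 (y / (2 * Real.pi * r))
  rw [← h2, Real.fourierInv_eq']
  have h3 := MeasureTheory.Measure.integral_comp_mul_left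
    (fun v : ℝ => 𝓕 (χ : ℝ → ℂ) v * exp (I * (y / r : ℝ) * v)) r
  have e1 : ∀ l : ℝ, 𝓕 (χ : ℝ → ℂ) (r * l) * exp (I * y * l)
      = 𝓕 (χ : ℝ → ℂ) (r * l) * exp (I * (y / r : ℝ) * ((r * l : ℝ) : ℂ)) := by
    intro l
    congr 2
    push_cast
    have : (r : ℂ) ≠ 0 := by exact_mod_cast hr.ne'
    field_simp
  simp_rw [e1]
  rw [h3, abs_of_pos (inv_pos.2 hr), Complex.real_smul]
  congr 1
  apply integral_congr_ae
  filter_upwards with v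
  rw [smul_eq_mul, mul_comm]
  congr 2
  simp only [RCLike.inner_apply, conj_trivial]
  push_cast
  have : (r : ℂ) ≠ 0 := by exact_mod_cast hr.ne'
  have : (Real.pi : ℂ) ≠ 0 := by exact_mod_cast Real.pi_pos.ne'
  field_simp

open Complex in
open scoped FourierTransform SchwartzMap in
theorem aux_flip (ψ χ : 𝓢(ℝ, ℂ)) (r d u v ρ : ℝ) (hr : 0 < r) (hd : 0 < d)
    (h0 : ∀ x : ℝ, ψ ((x + u / (2 * Real.pi)) / r) * χ ((v - 2 * Real.pi * x) / (2 * Real.pi * d)) = 0) :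
    ∫ m : ℝ, (𝓕 (ψ : ℝ → ℂ) (r * (m + ρ)) * exp (I * u * ((m + ρ : ℝ) : ℂ))) *
      (𝓕 (χ : ℝ → ℂ) (d * m) * exp (I * v * m)) = 0 := by
  have hpi := Real.pi_pos
  have hrC : (r : ℂ) ≠ 0 := by exact_mod_cast hr.ne'
  have hpC : (Real.pi : ℂ) ≠ 0 := by exact_mod_cast Real.pi_pos.ne'
  set F : ℝ → ℂ := fun x => exp (-2 * Real.pi * I * ρ * x) * ψ ((x + u / (2 * Real.pi)) / r) with hF
  set g : ℝ → ℂ := fun m => 𝓕 (χ : ℝ → ℂ) (d * m) * exp (I * v * m) with hg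
  have hgF : ∀ x, 𝓕 g x = (d⁻¹ : ℝ) * χ ((v - 2 * Real.pi * x) / (2 * Real.pi * d)) := by
    intro x
    rw [← aux_inv χ d hd, Real.fourier_eq']
    apply integral_congr_ae
    filter_upwards with m
    rw [smul_eq_mul, hg]
    simp only []
    rw [mul_left_comm, ← Complex.exp_add]
    congr 2
    simp only [RCLike.inner_apply, conj_trivial]
    push_cast
    ring
  have hFF : ∀ m, 𝓕 F m = (r : ℂ) * (𝓕 (ψ : ℝ → ℂ) (r * (m + ρ)) * exp (I * u * ((m + ρ : ℝ) : ℂ))) := by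
    intro m
    rw [Real.fourier_eq', Real.fourier_eq']
    have h3 := MeasureTheory.Measure.integral_comp_mul_left
      (fun x : ℝ => exp (((-2 * Real.pi * inner ℝ x m : ℝ) : ℂ) * I) • F x) r
    have h4 := MeasureTheory.integral_add_right_eq_self (μ := volume)
      (fun x : ℝ => exp (((-2 * Real.pi * inner ℝ (r * x) m : ℝ) : ℂ) * I) • F (r * x)) (- (u / (2 * Real.pi * r)))
    rw [← h4, abs_of_pos (inv_pos.2 hr), Complex.real_smul] at h3
    have h5 : ∫ x : ℝ, exp (((-2 * Real.pi * inner ℝ x m : ℝ) : ℂ) * I) • F x =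
      r * ∫ (x : ℝ), cexp (((-2 * Real.pi * inner ℝ (r * (x + -(u / (2 * Real.pi * r)))) m : ℝ) : ℂ) * I) • F (r * (x + -(u / (2 * Real.pi * r)))) := by
      rw [h3, ← mul_assoc]; push_cast; rw [mul_inv_cancel₀ hrC, one_mul]
    rw [h5, ← integral_mul_const]
    congr 1
    apply integral_congr_ae
    filter_upwards with x
    simp only [hF, smul_eq_mul, RCLike.inner_apply, conj_trivial]
    have e : (r * (x + -(u / (2 * Real.pi * r))) + u / (2 * Real.pi)) / r = x := by
      field_simp; ring
    rw [e, ← mul_assoc, ← Complex.exp_add, mul_right_comm _ (ψ x) _, ← Complex.exp_add]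
    congr 2
    push_cast
    field_simp
    ring
  have hFi : Integrable F := by
    have h1 : Integrable (fun x : ℝ => ψ ((x + u / (2 * Real.pi)) / r)) := by
      have := (ψ.integrable (μ := volume)).comp_div hr.ne'
      exact this.comp_add_right (u / (2 * Real.pi))
    refine h1.bdd_mul (c := 1) (by fun_prop) ?_
    filter_upwards with x
    have : (-2 * Real.pi * I * ρ * x : ℂ) = ((-2 * Real.pi * ρ * x : ℝ) : ℂ) * I := by push_cast; ring
    rw [this, Complex.norm_exp_ofReal_mul_I]
  have hgi : Integrable g := by
    have h1 : Integrable (fun m : ℝ => 𝓕 (χ : ℝ → ℂ) (d * m)) := by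
      have := ((𝓕 χ).integrable (μ := volume)).comp_mul_left' hd.ne'
      exact this
    refine h1.mul_bdd (c := 1) (by fun_prop) ?_
    filter_upwards with x
    have : (I * v * x : ℂ) = ((v * x : ℝ) : ℂ) * I := by push_cast; ring
    rw [this, Complex.norm_exp_ofReal_mul_I]
  have key : ∫ m, 𝓕 F m • g m = ∫ x, F x • 𝓕 g x := by
    simpa using! (VectorFourier.integral_fourierIntegral_smul_eq_flip (L := innerₗ ℝ)
      Real.continuous_fourierChar continuous_inner hFi hgi)
  have e2 : ∀ x, F x • 𝓕 g x = 0 := by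
    intro x
    rw [hgF, smul_eq_mul, hF]
    simp only []
    linear_combination (cexp (-2 * Real.pi * I * ρ * x) * (d⁻¹ : ℝ)) * h0 x
  simp_rw [e2, hFF, smul_eq_mul, mul_assoc] at key
  rw [integral_const_mul, integral_zero, mul_eq_zero] at key
  have := key.resolve_left hrC
  simp only [hg, mul_assoc] at this ⊢
  exact this

open Complex in
open scoped FourierTransform SchwartzMap in
/-- The rescaled and modulated test factor. -/
noncomputable def Pk (ψ : 𝓢(ℝ, ℂ)) (r u l : ℝ) : ℂ := (r : ℂ) * (𝓕 (ψ : ℝ → ℂ) (r * l) * exp (I * u * l))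

open scoped FourierTransform SchwartzMap in
theorem aux_expI (x : ℝ) : ‖Complex.exp (Complex.I * x)‖ = 1 := by
  rw [mul_comm, Complex.norm_exp_ofReal_mul_I]

open scoped FourierTransform SchwartzMap in
theorem Pk_norm (ψ : 𝓢(ℝ, ℂ)) (r u l : ℝ) (hr : 0 < r) :
    ‖Pk ψ r u l‖ = r * ‖𝓕 (ψ : ℝ → ℂ) (r * l)‖ := by
  have : Complex.I * u * l = Complex.I * ((u * l : ℝ) : ℂ) := by push_cast; ring
  rw [Pk, norm_mul, norm_mul, this, aux_expI, mul_one, Complex.norm_real, Real.norm_of_nonneg hr.le]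

open scoped FourierTransform SchwartzMap in
theorem Pk_cont (ψ : 𝓢(ℝ, ℂ)) (r u : ℝ) : Continuous (Pk ψ r u) := by
  unfold Pk
  have h : Continuous (𝓕 (ψ : ℝ → ℂ)) := (𝓕 ψ).continuous
  fun_prop

open scoped FourierTransform SchwartzMap in
theorem Pk_int (ψ : 𝓢(ℝ, ℂ)) (r u : ℝ) (hr : 0 < r) : Integrable (Pk ψ r u) := by
  have h1 : Integrable (fun m : ℝ => (r : ℂ) * 𝓕 (ψ : ℝ → ℂ) (r * m)) := by
    have := ((𝓕 ψ).integrable (μ := volume)).comp_mul_left' hr.ne'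
    exact this.const_mul _
  refine h1.mono (Pk_cont ψ r u).aestronglyMeasurable ?_
  filter_upwards with l
  rw [Pk_norm _ _ _ _ hr, norm_mul, Complex.norm_real, Real.norm_of_nonneg hr.le]

open scoped FourierTransform SchwartzMap in
theorem Pk_int' (ψ : 𝓢(ℝ, ℂ)) (r u : ℝ) (hr : 0 < r) : Integrable (fun l : ℝ => (l : ℂ) * Pk ψ r u l) := by
  have h1 : Integrable (fun m : ℝ => ‖(r * m)‖ ^ 1 * ‖𝓕 (ψ : ℝ → ℂ) (r * m)‖) := by
    have := ((𝓕 ψ).integrable_pow_mul (μ := volume) 1).comp_mul_left' hr.ne'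
    exact this
  refine h1.mono (Complex.continuous_ofReal.mul (Pk_cont ψ r u)).aestronglyMeasurable ?_
  filter_upwards with l
  rw [norm_mul, Pk_norm _ _ _ _ hr, Complex.norm_real, norm_mul, norm_norm, norm_pow, norm_norm,
    norm_mul, Real.norm_of_nonneg hr.le]
  apply le_of_eq; ring

open scoped FourierTransform SchwartzMap in
theorem Pk_inv (ψ : 𝓢(ℝ, ℂ)) (r u y : ℝ) (hr : 0 < r) :
    ∫ l : ℝ, Pk ψ r u l * Complex.exp (-Complex.I * y * l) = ψ ((u - y) / (2 * Real.pi * r)) := by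
  have h := aux_inv ψ r hr (u - y)
  have hrC : (r : ℂ) ≠ 0 := by exact_mod_cast hr.ne'
  have e : ∀ l : ℝ, Pk ψ r u l * Complex.exp (-Complex.I * y * l) =
      (r : ℂ) * (𝓕 (ψ : ℝ → ℂ) (r * l) * Complex.exp (Complex.I * (u - y : ℝ) * l)) := by
    intro l
    rw [Pk, mul_assoc, mul_assoc, ← Complex.exp_add]
    congr 3
    push_cast; ring
  simp_rw [e]
  rw [integral_const_mul, h, ← mul_assoc]
  push_cast
  rw [mul_inv_cancel₀ hrC, one_mul]

open scoped FourierTransform SchwartzMap in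
theorem Pk_vanish (ψ : 𝓢(ℝ, ℂ)) (h1 : ∀ x : ℝ, 1 ≤ 2 * Real.pi * |x| → ψ x = 0)
    (h2 : ∀ x : ℝ, 1 < 2 * Real.pi * |x| → SchwartzMap.derivCLM ℂ ℂ ψ x = 0)
    (r d u v ρ : ℝ) (hr : 0 < r) (hd : 0 < d) (h : r + d < u + v) :
    ∫ m : ℝ, Pk ψ r u (m + ρ) * (m * Pk ψ d v m) = 0 := by
  have hpi := Real.pi_pos
  have hpC : (Real.pi : ℂ) ≠ 0 := by exact_mod_cast Real.pi_pos.ne'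
  have hF := aux_flip ψ (SchwartzMap.derivCLM ℂ ℂ ψ) r d u v ρ hr hd (by
    intro x
    by_cases hx : 1 ≤ 2 * Real.pi * |(x + u / (2 * Real.pi)) / r|
    · rw [h1 _ hx, zero_mul]
    · rw [h2, mul_zero]
      push Not at hx
      rw [abs_div, abs_of_pos hr, mul_div_assoc', div_lt_one hr] at hx
      rw [abs_div, abs_of_pos (by positivity : 0 < 2 * Real.pi * d), mul_div_assoc', lt_div_iff₀ (by positivity)]
      have e1 : 2 * Real.pi * |x + u / (2 * Real.pi)| = |2 * Real.pi * x + u| := by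
        rw [← abs_of_pos (by positivity : 0 < 2 * Real.pi), ← abs_mul, abs_of_pos (by positivity : 0 < 2 * Real.pi)]
        congr 1; field_simp
      rw [e1] at hx
      have h3 := (abs_lt.1 hx).2
      have h4 := le_abs_self (v - 2 * Real.pi * x)
      have : d < |v - 2 * Real.pi * x| := by linarith
      nlinarith)
  have hder : ∀ y : ℝ, 𝓕 (SchwartzMap.derivCLM ℂ ℂ ψ : ℝ → ℂ) y = (2 * Real.pi * Complex.I * y) * 𝓕 (ψ : ℝ → ℂ) y := by
    intro y
    have : (SchwartzMap.derivCLM ℂ ℂ ψ : ℝ → ℂ) = deriv ψ := by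
      ext y; rw [SchwartzMap.derivCLM_apply]
    rw [this, Real.fourier_deriv ψ.integrable ψ.differentiable]
    · simp
    · rw [← this]; exact SchwartzMap.integrable _
  have e : ∀ m : ℝ, Pk ψ r u (m + ρ) * (m * Pk ψ d v m) = (r / (2 * Real.pi * Complex.I)) *
     ((𝓕 (ψ : ℝ → ℂ) (r * (m + ρ)) * Complex.exp (Complex.I * u * ((m + ρ : ℝ) : ℂ))) *
      (𝓕 (SchwartzMap.derivCLM ℂ ℂ ψ : ℝ → ℂ) (d * m) * Complex.exp (Complex.I * v * m))) := by
    intro m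
    rw [hder, Pk, Pk]
    push_cast
    field_simp
  simp_rw [e]
  rw [integral_const_mul, hF, mul_zero]

open scoped FourierTransform SchwartzMap in
theorem Pk_vanish' (ψ : 𝓢(ℝ, ℂ)) (h1 : ∀ x : ℝ, 1 ≤ 2 * Real.pi * |x| → ψ x = 0)
    (h2 : ∀ x : ℝ, 1 < 2 * Real.pi * |x| → SchwartzMap.derivCLM ℂ ℂ ψ x = 0)
    (r d u v ρ : ℝ) (hr : 0 < r) (hd : 0 < d) (h : r + d < u + v) :
    ∫ m : ℝ, ((m + ρ : ℝ) * Pk ψ r u (m + ρ)) * Pk ψ d v m = 0 := by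
  have h3 := Pk_vanish ψ h1 h2 d r v u (-ρ) hd hr (by linarith)
  have h4 := MeasureTheory.integral_add_right_eq_self (μ := volume)
      (fun m : ℝ => Pk ψ d v (m + -ρ) * (m * Pk ψ r u m)) ρ
  rw [h3] at h4
  rw [← h4]
  congr 1
  ext m
  rw [add_neg_cancel_right, mul_comm]

/-- The kernel restricted to a line, with a signed radial variable. -/
noncomputable def sgK (t p τ ρ : ℝ) : ℂ :=
  (Complex.exp (-Complex.I * ((ρ * p : ℝ) : ℂ)) / (2 * (ρ : ℂ))) *
    ((Complex.exp (-Complex.I * (t : ℂ) * (τ : ℂ)) -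
        Complex.exp (Complex.I * (t : ℂ) * (ρ : ℂ))) / ((τ : ℂ) + (ρ : ℂ)) -
      (Complex.exp (-Complex.I * (t : ℂ) * (τ : ℂ)) -
        Complex.exp (-Complex.I * (t : ℂ) * (ρ : ℂ))) / ((τ : ℂ) - (ρ : ℂ)))

theorem aux_expsub (x : ℝ) : ‖1 - Complex.exp (Complex.I * x)‖ ≤ |x| := by
  rw [norm_sub_rev]
  exact Real.norm_exp_I_mul_ofReal_sub_one_le

/-- Bounded factor. -/
noncomputable def kf (y L ρ : ℝ) : ℂ :=
  Complex.exp (Complex.I * ((y * ρ : ℝ) : ℂ)) * (1 - Complex.exp (Complex.I * ((L * ρ : ℝ) : ℂ))) / ρ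

theorem kf_bound (y L ρ : ℝ) : ‖kf y L ρ‖ ≤ |L| := by
  rw [kf, norm_div, norm_mul, aux_expI, one_mul, Complex.norm_real, Real.norm_eq_abs]
  have := aux_expsub (L * ρ)
  rw [abs_mul] at this
  exact div_le_of_le_mul₀ (abs_nonneg _) (abs_nonneg _) this

theorem kf_meas (y L : ℝ) : Measurable (kf y L) := by
  unfold kf
  fun_prop

theorem aux_shear (k f g : ℝ → ℂ) (hk : Measurable k) (c : ℝ) (hkb : ∀ x, ‖k x‖ ≤ c)
    (hf : Integrable f) (hg : Integrable g) (h0 : ∀ ρ : ℝ, ∫ m : ℝ, f (m + ρ) * g m = 0) :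
    Integrable (fun z : ℝ × ℝ => k (z.1 - z.2) * (f z.1 * g z.2)) (volume.prod volume) ∧
    ∫ z : ℝ × ℝ, k (z.1 - z.2) * (f z.1 * g z.2) ∂(volume.prod volume) = 0 := by
  have hi : Integrable (fun z : ℝ × ℝ => k (z.1 - z.2) * (f z.1 * g z.2)) (volume.prod volume) := by
    refine (hf.mul_prod hg).bdd_mul (c := c) ?_ ?_
    · exact (hk.comp (measurable_fst.sub measurable_snd)).aestronglyMeasurable
    · filter_upwards with z using hkb _
  refine ⟨hi, ?_⟩
  have mp := measurePreserving_add_prod (G := ℝ) (volume : Measure ℝ) (volume : Measure ℝ)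
  have hi2 := (mp.integrable_comp hi.aestronglyMeasurable).2 hi
  have me : MeasurableEmbedding (fun z : ℝ × ℝ => (z.1 + z.2, z.2)) := by
    refine MeasurableEmbedding.of_measurable_inverse (g := fun z : ℝ × ℝ => (z.1 - z.2, z.2))
      (by fun_prop) ?_ (by fun_prop) ?_
    · have : range (fun z : ℝ × ℝ => (z.1 + z.2, z.2)) = univ :=
        Set.range_eq_univ.2 (fun z => ⟨(z.1 - z.2, z.2), by simp⟩)
      rw [this]; exact MeasurableSet.univ
    · intro z; simp
  have mp' : MeasurePreserving (fun z : ℝ × ℝ => (z.1 + z.2, z.2)) (volume.prod volume) (volume.prod volume) := by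
    simpa [add_comm] using mp
  rw [← mp'.integral_comp me]
  have hi3 := (mp'.integrable_comp hi.aestronglyMeasurable).2 hi
  refine (integral_prod _ hi3).trans ?_
  simp only [Function.comp, add_sub_cancel_right]
  have : ∀ x : ℝ, ∫ y : ℝ, k x * (f (x + y) * g y) = 0 := by
    intro x
    rw [integral_const_mul]
    have := h0 x
    simp_rw [add_comm _ x] at this
    rw [this, mul_zero]
  simp_rw [this]
  simp

theorem aux_ae : ∀ᵐ z : ℝ × ℝ ∂((volume : Measure ℝ).prod volume), z.1 ≠ 0 ∧ z.2 ≠ 0 ∧ z.1 ≠ z.2 ∧ z.1 + z.2 ≠ 0 := by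
  have hm : MeasurableSet {z : ℝ × ℝ | z.1 ≠ 0 ∧ z.2 ≠ 0 ∧ z.1 ≠ z.2 ∧ z.1 + z.2 ≠ 0} := by
    apply MeasurableSet.inter
    · exact (measurableSet_eq_fun measurable_fst measurable_const).compl
    · apply MeasurableSet.inter
      · exact (measurableSet_eq_fun measurable_snd measurable_const).compl
      · apply MeasurableSet.inter
        · exact (measurableSet_eq_fun measurable_fst measurable_snd).compl
        · exact (measurableSet_eq_fun (measurable_fst.add measurable_snd) measurable_const).compl
  rw [Measure.ae_prod_iff_ae_ae hm]
  filter_upwards [Measure.ae_ne volume (0 : ℝ)] with x hx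
  filter_upwards [Measure.ae_ne volume (0 : ℝ), Measure.ae_ne volume x, Measure.ae_ne volume (-x)]
    with y hy hxy hxy'
  refine ⟨hx, hy, fun h => hxy h.symm, fun h => hxy' (by linarith)⟩

open scoped SchwartzMap in
/-- The test function. -/
noncomputable def Phi (ψ : 𝓢(ℝ, ℂ)) (r d u v L l m : ℝ) : ℂ :=
  (l : ℂ) * m * Pk ψ r u l * Pk ψ d v m * (1 - Complex.exp (Complex.I * ((L * (l - m) : ℝ) : ℂ)))

open scoped SchwartzMap in
theorem sgK_decomp (ψ : 𝓢(ℝ, ℂ)) (r d u v L t p l m : ℝ) (hl : l ≠ 0) (hm : m ≠ 0) (hlm : l ≠ m) :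
    sgK t p (l + m) (l - m) * Phi ψ r d u v L l m =
    (-(1/4) * ((Pk ψ r u l * Complex.exp (-Complex.I * (t + p : ℝ) * l)) *
        (Pk ψ d v m * Complex.exp (-Complex.I * (t - p : ℝ) * m)))
     + (1/4) * ((Pk ψ r u l * Complex.exp (-Complex.I * (t + p - L : ℝ) * l)) *
        (Pk ψ d v m * Complex.exp (-Complex.I * (t - p + L : ℝ) * m))))
    + (-(1/4) * (kf (t - p) L (l - m) * (Pk ψ r u l * (m * Pk ψ d v m))) +
      (1/4) * (kf (-(t + p)) L (l - m) * ((l * Pk ψ r u l) * Pk ψ d v m))) := by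
  have hlC : (l : ℂ) ≠ 0 := by exact_mod_cast hl
  have hmC : (m : ℂ) ≠ 0 := by exact_mod_cast hm
  have hlmC : (l : ℂ) - m ≠ 0 := by
    intro h; exact hlm (by exact_mod_cast sub_eq_zero.1 h)
  unfold sgK Phi kf
  generalize Pk ψ r u l = P
  generalize Pk ψ d v m = Q
  set e1 := Complex.exp (Complex.I * (t * l)) with he1
  set e2 := Complex.exp (Complex.I * (t * m)) with he2
  set e3 := Complex.exp (Complex.I * (p * l)) with he3
  set e4 := Complex.exp (Complex.I * (p * m)) with he4
  set e5 := Complex.exp (Complex.I * (L * l)) with he5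
  set e6 := Complex.exp (Complex.I * (L * m)) with he6
  have n1 : e1 ≠ 0 := Complex.exp_ne_zero _
  have n2 : e2 ≠ 0 := Complex.exp_ne_zero _
  have n3 : e3 ≠ 0 := Complex.exp_ne_zero _
  have n4 : e4 ≠ 0 := Complex.exp_ne_zero _
  have n5 : e5 ≠ 0 := Complex.exp_ne_zero _
  have n6 : e6 ≠ 0 := Complex.exp_ne_zero _
  have x1 : Complex.exp (-Complex.I * (((l - m) * p : ℝ) : ℂ)) = e4 / e3 := by
    rw [he3, he4, ← Complex.exp_sub]; congr 1; push_cast; ring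
  have x2 : Complex.exp (-Complex.I * (t : ℂ) * ((l + m : ℝ) : ℂ)) = 1 / (e1 * e2) := by
    rw [he1, he2, ← Complex.exp_add, one_div, ← Complex.exp_neg]; congr 1; push_cast; ring
  have x3 : Complex.exp (Complex.I * (t : ℂ) * ((l - m : ℝ) : ℂ)) = e1 / e2 := by
    rw [he1, he2, ← Complex.exp_sub]; congr 1; push_cast; ring
  have x4 : Complex.exp (-Complex.I * (t : ℂ) * ((l - m : ℝ) : ℂ)) = e2 / e1 := by
    rw [he1, he2, ← Complex.exp_sub]; congr 1; push_cast; ring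
  have x5 : Complex.exp (Complex.I * ((L * (l - m) : ℝ) : ℂ)) = e5 / e6 := by
    rw [he5, he6, ← Complex.exp_sub]; congr 1; push_cast; ring
  have x6 : Complex.exp (-Complex.I * (t + p : ℝ) * l) = 1 / (e1 * e3) := by
    rw [he1, he3, ← Complex.exp_add, one_div, ← Complex.exp_neg]; congr 1; push_cast; ring
  have x7 : Complex.exp (-Complex.I * (t - p : ℝ) * m) = e4 / e2 := by
    rw [he4, he2, ← Complex.exp_sub]; congr 1; push_cast; ring
  have x8 : Complex.exp (-Complex.I * (t + p - L : ℝ) * l) = e5 / (e1 * e3) := by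
    rw [he1, he3, he5, ← Complex.exp_add, ← Complex.exp_sub]; congr 1; push_cast; ring
  have x9 : Complex.exp (-Complex.I * (t - p + L : ℝ) * m) = e4 / (e2 * e6) := by
    rw [he4, he2, he6, ← Complex.exp_add, ← Complex.exp_sub]; congr 1; push_cast; ring
  have x10 : Complex.exp (Complex.I * (((t - p) * (l - m) : ℝ) : ℂ)) = e1 * e4 / (e2 * e3) := by
    rw [he1, he2, he3, he4, ← Complex.exp_add, ← Complex.exp_add, ← Complex.exp_sub]
    congr 1; push_cast; ring
  have x11 : Complex.exp (Complex.I * ((-(t + p) * (l - m) : ℝ) : ℂ)) = e2 * e4 / (e1 * e3) := by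
    rw [he1, he2, he3, he4, ← Complex.exp_add, ← Complex.exp_add, ← Complex.exp_sub]
    congr 1; push_cast; ring
  rw [x1, x2, x3, x4, x5, x6, x7, x8, x9, x10, x11]
  have d1 : ((l + m : ℝ) : ℂ) + ((l - m : ℝ) : ℂ) = 2 * l := by push_cast; ring
  have d2 : ((l + m : ℝ) : ℂ) - ((l - m : ℝ) : ℂ) = 2 * m := by push_cast; ring
  rw [d1, d2]
  have d3 : ((l - m : ℝ) : ℂ) = (l : ℂ) - m := by push_cast; ring
  rw [d3]
  clear_value e1 e2 e3 e4 e5 e6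
  clear x1 x2 x3 x4 x5 x6 x7 x8 x9 x10 x11 he1 he2 he3 he4 he5 he6
  set D := (l : ℂ) - m with hD
  have hlD : (l : ℂ) = D + m := by rw [hD]; ring
  clear_value D
  field_simp
  rw [hlD]
  ring

open scoped SchwartzMap in
theorem sgK_integral (ψ : 𝓢(ℝ, ℂ)) (h1 : ∀ x : ℝ, 1 ≤ 2 * Real.pi * |x| → ψ x = 0)
    (h2 : ∀ x : ℝ, 1 < 2 * Real.pi * |x| → SchwartzMap.derivCLM ℂ ℂ ψ x = 0)
    (r d u v L t p : ℝ) (hr : 0 < r) (hd : 0 < d) (h : r + d < u + v) :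
    Integrable (fun z : ℝ × ℝ => sgK t p (z.1 + z.2) (z.1 - z.2) * Phi ψ r d u v L z.1 z.2) (volume.prod volume) ∧
    ∫ z : ℝ × ℝ, sgK t p (z.1 + z.2) (z.1 - z.2) * Phi ψ r d u v L z.1 z.2 ∂(volume.prod volume)
     = -(1/4) * (ψ ((u - (t + p)) / (2 * Real.pi * r)) * ψ ((v - (t - p)) / (2 * Real.pi * d))) +
      (1/4) * (ψ ((u - (t + p - L)) / (2 * Real.pi * r)) * ψ ((v - (t - p + L)) / (2 * Real.pi * d))) := by
  have hP : ∀ (r u y : ℝ), 0 < r → Integrable (fun l : ℝ => Pk ψ r u l * Complex.exp (-Complex.I * y * l)) := by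
    intro r u y hr
    refine (Pk_int ψ r u hr).mul_bdd (c := 1) (by fun_prop) ?_
    filter_upwards with x
    have : (-Complex.I * y * x : ℂ) = Complex.I * ((-(y * x) : ℝ) : ℂ) := by push_cast; ring
    rw [this, aux_expI]
  have i1 := ((hP r u (t + p) hr).mul_prod (hP d v (t - p) hd)).const_mul (-(1/4))
  have i2 := ((hP r u (t + p - L) hr).mul_prod (hP d v (t - p + L) hd)).const_mul (1/4)
  obtain ⟨i3, z3⟩ := aux_shear (kf (t - p) L) (Pk ψ r u) (fun m : ℝ => m * Pk ψ d v m) (kf_meas _ _) _ (kf_bound _ _)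
    (Pk_int ψ r u hr) (Pk_int' ψ d v hd) (fun ρ => Pk_vanish ψ h1 h2 r d u v ρ hr hd h)
  obtain ⟨i4, z4⟩ := aux_shear (kf (-(t + p)) L) (fun m : ℝ => m * Pk ψ r u m) (Pk ψ d v) (kf_meas _ _) _ (kf_bound _ _)
    (Pk_int' ψ r u hr) (Pk_int ψ d v hd) (fun ρ => Pk_vanish' ψ h1 h2 r d u v ρ hr hd h)
  have i3' := i3.const_mul (-(1/4))
  have i4' := i4.const_mul (1/4)
  have ae := aux_ae.mono (fun z hz => sgK_decomp ψ r d u v L t p z.1 z.2 hz.1 hz.2.1 hz.2.2.1)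
  have hi := (i1.add i2).add (i3'.add i4')
  constructor
  · refine hi.congr ?_
    filter_upwards [ae] with z hz
    rw [hz]; rfl
  · rw [integral_congr_ae ae]
    rw [integral_add, integral_add, integral_add]
    · simp_rw [integral_const_mul]
      rw [z3, z4, mul_zero, mul_zero, add_zero, add_zero]
      rw [integral_prod_mul (fun l : ℝ => Pk ψ r u l * Complex.exp (-Complex.I * (t + p : ℝ) * l))
        (fun m : ℝ => Pk ψ d v m * Complex.exp (-Complex.I * (t - p : ℝ) * m)),
        integral_prod_mul (fun l : ℝ => Pk ψ r u l * Complex.exp (-Complex.I * (t + p - L : ℝ) * l))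
        (fun m : ℝ => Pk ψ d v m * Complex.exp (-Complex.I * (t - p + L : ℝ) * m)),
        Pk_inv _ _ _ _ hr, Pk_inv _ _ _ _ hd, Pk_inv _ _ _ _ hr, Pk_inv _ _ _ _ hd]
    · exact i3'
    · exact i4'
    · exact i1
    · exact i2
    · exact i1.add i2
    · exact i3'.add i4'

open scoped FourierTransform SchwartzMap in
theorem S_int (f : 𝓢(ℝ, ℂ)) : Integrable (fun x : ℝ => (1 + |x|) ^ 7 * ‖f x‖ ^ 2) := by
  obtain ⟨M, hM⟩ := f.decay 0 0
  have hM' : ∀ x, ‖f x‖ ≤ M := by intro x; simpa using hM.2 x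
  have i0 := (f.integrable_pow_mul (μ := volume) 0)
  have i7 := (f.integrable_pow_mul (μ := volume) 7)
  refine ((i0.add i7).const_mul (2 ^ 6 * M)).mono ?_ ?_
  · have := f.continuous
    exact Continuous.aestronglyMeasurable (by fun_prop)
  · filter_upwards with x
    have h1 : (1 + |x|) ^ 7 ≤ 2 ^ 6 * (1 ^ 7 + |x| ^ 7) := add_pow_le zero_le_one (abs_nonneg x) 7
    have h2 := hM' x
    have h3 := norm_nonneg (f x)
    have h4 : (0:ℝ) ≤ M := h3.trans h2
    rw [Real.norm_of_nonneg (by positivity), Real.norm_of_nonneg (by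
      simp only [Pi.add_apply]; positivity)]
    simp only [Pi.add_apply, pow_zero, one_mul, Real.norm_eq_abs]
    calc (1 + |x|) ^ 7 * ‖f x‖ ^ 2 ≤ (2 ^ 6 * (1 ^ 7 + |x| ^ 7)) * (M * ‖f x‖) := by
          gcongr
          rw [sq]; gcongr
      _ = _ := by ring

open scoped FourierTransform SchwartzMap in
theorem Phi_pt (ψ : 𝓢(ℝ, ℂ)) (H γ d L : ℝ) (hH : 1 / 2 ≤ H) (hγ : -2 < γ) (hHγ : 2 * H + γ < 2)
    (hd : 0 < d) (hd1 : d ≤ 1) (r u v l m : ℝ) (hr : 0 < r) (hr1 : r ≤ 1) (hlm : l ≠ m) :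
    ‖Phi ψ r d u v L l m‖ ^ 2 * (|l + m| ^ (2 * H - 1) * |l - m| ^ γ) ≤
      ((8 + 2 * L ^ 2) * d ^ 2 / d ^ 7) * r ^ (1 - (2 * H + γ)) *
       (((1 + |r * l|) ^ 7 * ‖(𝓕 ψ) (r * l)‖ ^ 2) * ((1 + |d * m|) ^ 7 * ‖(𝓕 ψ) (d * m)‖ ^ 2)) := by
  have hρ : 0 < |l - m| := abs_pos.2 (sub_ne_zero.2 hlm)
  set E := ‖1 - Complex.exp (Complex.I * ((L * (l - m) : ℝ) : ℂ))‖ with hE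
  have hE0 : 0 ≤ E := norm_nonneg _
  have hE2 : E ≤ 2 := by
    calc E ≤ ‖(1:ℂ)‖ + ‖Complex.exp (Complex.I * ((L * (l - m) : ℝ) : ℂ))‖ := norm_sub_le _ _
      _ = 2 := by rw [aux_expI]; norm_num
  have hEL : E ≤ |L * (l - m)| := aux_expsub _
  have hA : l ^ 2 * E ^ 2 ≤ (8 + 2 * L ^ 2 * m ^ 2) * |l - m| ^ 2 := by
    have h1 : E ^ 2 ≤ 4 := by nlinarith
    have h2 : E ^ 2 ≤ L ^ 2 * (l - m) ^ 2 := by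
      rw [← mul_pow, ← sq_abs (L * (l - m))]; gcongr
    have h3 : l ^ 2 ≤ 2 * (l - m) ^ 2 + 2 * m ^ 2 := by nlinarith [sq_nonneg (l - 2 * m)]
    rw [sq_abs]
    calc l ^ 2 * E ^ 2 ≤ (2 * (l - m) ^ 2 + 2 * m ^ 2) * E ^ 2 := by gcongr
      _ = 2 * (l - m) ^ 2 * E ^ 2 + 2 * m ^ 2 * E ^ 2 := by ring
      _ ≤ 2 * (l - m) ^ 2 * 4 + 2 * m ^ 2 * (L ^ 2 * (l - m) ^ 2) := by gcongr
      _ = _ := by ring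
  set x := 1 + |r * l| with hx
  set y := 1 + |m| with hy
  have hx1 : 1 ≤ x := by rw [hx]; linarith [abs_nonneg (r * l)]
  have hy1 : 1 ≤ y := by rw [hy]; linarith [abs_nonneg m]
  have hC : |l| + |m| ≤ x * y / r := by
    rw [le_div_iff₀ hr, hx, hy, abs_mul, abs_of_pos hr]
    have := abs_nonneg l
    have := abs_nonneg m
    nlinarith [mul_nonneg (mul_nonneg hr.le (abs_nonneg l)) (abs_nonneg m), mul_nonneg (sub_nonneg.2 hr1) (abs_nonneg m)]
  have hB : |l - m| ^ 2 * (|l + m| ^ (2 * H - 1) * |l - m| ^ γ) ≤ r ^ (-(1 + 2 * H + γ)) * (x * y) ^ 3 := by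
    have e1 : |l - m| ^ 2 * |l - m| ^ γ = |l - m| ^ (2 + γ) := by
      rw [Real.rpow_add hρ]; norm_num
    have b1 : |l - m| ≤ x * y / r := (abs_sub l m).trans hC
    have b2 : |l + m| ≤ x * y / r := (abs_add_le l m).trans hC
    have hxy : 0 < x * y / r := by positivity
    calc |l - m| ^ 2 * (|l + m| ^ (2 * H - 1) * |l - m| ^ γ) = |l + m| ^ (2 * H - 1) * |l - m| ^ (2 + γ) := by
          rw [← e1]; ring
      _ ≤ (x * y / r) ^ (2 * H - 1) * (x * y / r) ^ (2 + γ) := by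
          apply mul_le_mul
          · exact Real.rpow_le_rpow (abs_nonneg _) b2 (by linarith)
          · exact Real.rpow_le_rpow (abs_nonneg _) b1 (by linarith)
          · positivity
          · positivity
      _ = (x * y / r) ^ (1 + 2 * H + γ) := by
          rw [← Real.rpow_add hxy]; congr 1; ring
      _ = r ^ (-(1 + 2 * H + γ)) * (x * y) ^ (1 + 2 * H + γ) := by
          rw [Real.div_rpow (by positivity) hr.le, Real.rpow_neg hr.le]; field_simp
      _ ≤ r ^ (-(1 + 2 * H + γ)) * (x * y) ^ (3 : ℝ) := by
          gcongr
          · nlinarith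
          · linarith
      _ = _ := by norm_cast
  have hy2 : y ≤ (1 + |d * m|) / d := by
    rw [le_div_iff₀ hd, hy, abs_mul, abs_of_pos hd]; nlinarith
  set A := ‖(𝓕 ψ) (r * l)‖ with hAdef
  set B := ‖(𝓕 ψ) (d * m)‖ with hBdef
  have hPhi : ‖Phi ψ r d u v L l m‖ ^ 2 = (l ^ 2 * E ^ 2) * (m ^ 2 * r ^ 2 * A ^ 2 * d ^ 2 * B ^ 2) := by
    rw [Phi, norm_mul, norm_mul, norm_mul, norm_mul, Pk_norm _ _ _ _ hr, Pk_norm _ _ _ _ hd,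
      Complex.norm_real, Complex.norm_real, Real.norm_eq_abs, Real.norm_eq_abs]
    rw [← sq_abs l, ← sq_abs m, ← SchwartzMap.fourier_coe]
    ring
  have hm : (8 + 2 * L ^ 2 * m ^ 2) * m ^ 2 * y ^ 3 ≤ (8 + 2 * L ^ 2) * ((1 + |d * m|) ^ 7 / d ^ 7) := by
    have hmy : m ^ 2 ≤ y ^ 2 := by
      rw [← sq_abs m, hy]; gcongr; linarith
    have hy4 : 1 ≤ y ^ 2 := by nlinarith
    calc (8 + 2 * L ^ 2 * m ^ 2) * m ^ 2 * y ^ 3 ≤ (8 * y ^ 2 + 2 * L ^ 2 * y ^ 2) * y ^ 2 * y ^ 3 := by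
          gcongr; nlinarith
      _ = (8 + 2 * L ^ 2) * y ^ 7 := by ring
      _ ≤ (8 + 2 * L ^ 2) * ((1 + |d * m|) / d) ^ 7 := by gcongr
      _ = _ := by rw [div_pow]
  have hrr : r ^ 2 * r ^ (-(1 + 2 * H + γ)) = r ^ (1 - (2 * H + γ)) := by
    rw [← Real.rpow_natCast r 2, ← Real.rpow_add hr]; congr 1; push_cast; ring
  have hW0 : 0 ≤ |l + m| ^ (2 * H - 1) * |l - m| ^ γ := by positivity
  calc ‖Phi ψ r d u v L l m‖ ^ 2 * (|l + m| ^ (2 * H - 1) * |l - m| ^ γ)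
      = (l ^ 2 * E ^ 2) * ((m ^ 2 * r ^ 2 * A ^ 2 * d ^ 2 * B ^ 2) * (|l + m| ^ (2 * H - 1) * |l - m| ^ γ)) := by
        rw [hPhi]; ring
    _ ≤ ((8 + 2 * L ^ 2 * m ^ 2) * |l - m| ^ 2) * ((m ^ 2 * r ^ 2 * A ^ 2 * d ^ 2 * B ^ 2) * (|l + m| ^ (2 * H - 1) * |l - m| ^ γ)) := by
        gcongr
    _ = ((8 + 2 * L ^ 2 * m ^ 2) * m ^ 2 * r ^ 2 * A ^ 2 * d ^ 2 * B ^ 2) * (|l - m| ^ 2 * (|l + m| ^ (2 * H - 1) * |l - m| ^ γ)) := by ring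
    _ ≤ ((8 + 2 * L ^ 2 * m ^ 2) * m ^ 2 * r ^ 2 * A ^ 2 * d ^ 2 * B ^ 2) * (r ^ (-(1 + 2 * H + γ)) * (x * y) ^ 3) := by
        gcongr
    _ = ((8 + 2 * L ^ 2 * m ^ 2) * m ^ 2 * y ^ 3) * ((r ^ 2 * r ^ (-(1 + 2 * H + γ))) * (x ^ 3 * (A ^ 2 * d ^ 2 * B ^ 2))) := by ring
    _ ≤ ((8 + 2 * L ^ 2) * ((1 + |d * m|) ^ 7 / d ^ 7)) * ((r ^ 2 * r ^ (-(1 + 2 * H + γ))) * (x ^ 7 * (A ^ 2 * d ^ 2 * B ^ 2))) := by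
        gcongr
        · norm_num
    _ = _ := by rw [hrr]; ring

open scoped FourierTransform SchwartzMap in
theorem Y_bound (ψ : 𝓢(ℝ, ℂ)) (H γ d L : ℝ) (hH : 1 / 2 ≤ H) (hγ : -2 < γ) (hHγ : 2 * H + γ < 2)
    (hd : 0 < d) (hd1 : d ≤ 1) : ∃ Cy : ℝ, 0 < Cy ∧ ∀ r u v : ℝ, 0 < r → r ≤ 1 →
    ∫⁻ z : ℝ × ℝ, ENNReal.ofReal (‖Phi ψ r d u v L z.1 z.2‖ ^ 2 *
      (|z.1 + z.2| ^ (2 * H - 1) * |z.1 - z.2| ^ γ)) ∂(volume.prod volume) ≤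
      ENNReal.ofReal (Cy * r ^ (-(2 * H + γ))) := by
  set S : ℝ → ℝ := fun x => (1 + |x|) ^ 7 * ‖(𝓕 ψ) x‖ ^ 2 with hS
  have hSi : Integrable S := S_int (𝓕 ψ)
  have hS0 : ∀ x, 0 ≤ S x := fun x => by positivity
  have hI0 : 0 ≤ ∫ x, S x := integral_nonneg hS0
  set K := (8 + 2 * L ^ 2) * d ^ 2 / d ^ 7 with hK
  have hK0 : 0 < K := by positivity
  refine ⟨K * d⁻¹ * (∫ x, S x) ^ 2 + 1, by positivity, ?_⟩
  intro r u v hr hr1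
  have i1 : Integrable (fun l => S (r * l)) := hSi.comp_mul_left' hr.ne'
  have i2 : Integrable (fun l => S (d * l)) := hSi.comp_mul_left' hd.ne'
  have i3 := (i1.mul_prod i2).const_mul (K * r ^ (1 - (2 * H + γ)))
  have v1 : ∫ l, S (r * l) = r⁻¹ * ∫ x, S x := by
    rw [MeasureTheory.Measure.integral_comp_mul_left, abs_of_pos (inv_pos.2 hr), smul_eq_mul]
  have v2 : ∫ l, S (d * l) = d⁻¹ * ∫ x, S x := by
    rw [MeasureTheory.Measure.integral_comp_mul_left, abs_of_pos (inv_pos.2 hd), smul_eq_mul]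
  calc _ ≤ ∫⁻ z : ℝ × ℝ, ENNReal.ofReal (K * r ^ (1 - (2 * H + γ)) * (S (r * z.1) * S (d * z.2))) ∂(volume.prod volume) := by
        apply lintegral_mono_ae
        filter_upwards [aux_ae] with z hz
        apply ENNReal.ofReal_le_ofReal
        exact Phi_pt ψ H γ d L hH hγ hHγ hd hd1 r u v z.1 z.2 hr hr1 hz.2.2.1
    _ = ENNReal.ofReal (∫ z : ℝ × ℝ, (K * r ^ (1 - (2 * H + γ)) * (S (r * z.1) * S (d * z.2))) ∂(volume.prod volume)) := by
        rw [ofReal_integral_eq_lintegral_ofReal i3]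
        filter_upwards with z
        have := hS0 (r * z.1)
        have := hS0 (d * z.2)
        simp only [Pi.zero_apply]
        positivity
    _ ≤ _ := by
        apply ENNReal.ofReal_le_ofReal
        rw [integral_const_mul, integral_prod_mul (fun l => S (r * l)) (fun l => S (d * l)), v1, v2]
        have e : r ^ (1 - (2 * H + γ)) = r * r ^ (-(2 * H + γ)) := by
          rw [sub_eq_add_neg, Real.rpow_add hr, Real.rpow_one]
        rw [e]
        have h0 : 0 ≤ r ^ (-(2 * H + γ)) := by positivity
        have : K * (r * r ^ (-(2 * H + γ))) * (r⁻¹ * (∫ x, S x) * (d⁻¹ * ∫ x, S x)) =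
          (K * d⁻¹ * (∫ x, S x) ^ 2) * r ^ (-(2 * H + γ)) := by
          field_simp
        rw [this]
        nlinarith

theorem sgK_meas (t p : ℝ) : Measurable (fun z : ℝ × ℝ => sgK t p z.1 z.2) := by
  unfold sgK
  fun_prop

/-- The linear combination on a line. -/
noncomputable def sgF {n : ℕ} (t p : ℝ) (ts ps coef : Fin n → ℝ) (τ ρ : ℝ) : ℂ :=
  sgK t p τ ρ - ∑ j, (coef j : ℂ) * sgK (ts j) (ps j) τ ρ

theorem sgF_meas {n : ℕ} (t p : ℝ) (ts ps coef : Fin n → ℝ) :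
    Measurable (fun z : ℝ × ℝ => sgF t p ts ps coef z.1 z.2) := by
  unfold sgF
  refine (sgK_meas t p).sub (Finset.measurable_sum _ (fun j _ => ?_))
  exact (sgK_meas _ _).const_mul _

theorem line_bound (a H γ : ℝ) (ha : 0 < a) (hH : 1 / 2 ≤ H) (hγ : -2 < γ) (hHγ : 2 * H + γ < 2) :
    ∃ C : ℝ, 0 < C ∧ ∀ (n : ℕ) (t p : ℝ) (ts ps coef : Fin n → ℝ) (r : ℝ), a ≤ t → 0 < r →
      r ≤ min a 1 / 4 → (∀ j, r ≤ |(t - ts j) + (p - ps j)|) →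
      (∀ j, |(t - ts j) + (p - ps j)| ≤ min a 1 / 4) →
      ENNReal.ofReal (C * r ^ (2 * H + γ)) ≤
        ∫⁻ z : ℝ × ℝ, ENNReal.ofReal (‖sgF t p ts ps coef (z.1 + z.2) (z.1 - z.2)‖ ^ 2 *
          (|z.1 + z.2| ^ (1 - 2 * H) * |z.1 - z.2| ^ (-γ))) ∂(volume.prod volume) := by
  obtain ⟨ψ, hψ0, h1, h2⟩ := aux_bump
  have hpi := Real.pi_pos
  set r0 := min a 1 / 4 with hr0
  have hr0p : 0 < r0 := by positivity
  have hr0a : r0 ≤ a / 4 := by rw [hr0]; gcongr; exact min_le_left _ _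
  have hr01 : r0 ≤ 1 / 4 := by rw [hr0]; gcongr; exact min_le_right _ _
  set d := 2 * r0 with hd
  set L := 2 * r0 with hL
  obtain ⟨Cy, hCy, hY⟩ := Y_bound ψ H γ d L hH hγ hHγ (by positivity) (by rw [hd]; linarith)
  refine ⟨1 / (16 * Cy), by positivity, ?_⟩
  intro n t p ts ps coef r hat hr hrr0 hlow hup
  have hdp : 0 < d := by positivity
  have hz : ∀ (q b : ℝ), 0 < q → q ≤ |b| → ψ (b / (2 * Real.pi * q)) = 0 := by
    intro q b hq hb
    apply h1
    rw [abs_div, abs_of_pos (by positivity : 0 < 2 * Real.pi * q), mul_div_assoc', le_div_iff₀ (by positivity), one_mul]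
    nlinarith
  have hsum : r + d < (t + p) + (t - p) := by rw [hd]; linarith
  have hk := fun t' p' => sgK_integral ψ h1 h2 r d (t + p) (t - p) L t' p' hr hdp hsum
  set F := sgF t p ts ps coef with hF
  set Φ := Phi ψ r d (t + p) (t - p) L with hΦ
  have hmain : ∫ z : ℝ × ℝ, sgK t p (z.1 + z.2) (z.1 - z.2) * Φ z.1 z.2 ∂(volume.prod volume) = -(1/4) := by
    rw [(hk t p).2, sub_self, sub_self, zero_div, zero_div, hψ0,
      hz r (t + p - (t + p - L)) hr (by
        rw [sub_sub_cancel, abs_of_pos (by positivity), hL]; linarith)]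
    ring
  have hoth : ∀ j, ∫ z : ℝ × ℝ, sgK (ts j) (ps j) (z.1 + z.2) (z.1 - z.2) * Φ z.1 z.2 ∂(volume.prod volume) = 0 := by
    intro j
    have e1 : t + p - (ts j + ps j) = (t - ts j) + (p - ps j) := by ring
    have e2 : t + p - (ts j + ps j - L) = (t - ts j) + (p - ps j) + L := by ring
    rw [(hk (ts j) (ps j)).2, hz r _ hr (by rw [e1]; exact hlow j), hz r (t + p - (ts j + ps j - L)) hr]
    · ring
    · rw [e2]
      have := (abs_le.1 (hup j)).1
      refine le_trans ?_ (le_abs_self _)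
      rw [hL]; linarith
  have hFΦ : ∀ z : ℝ × ℝ, F (z.1 + z.2) (z.1 - z.2) * Φ z.1 z.2 =
      sgK t p (z.1 + z.2) (z.1 - z.2) * Φ z.1 z.2 -
      ∑ j, (coef j : ℂ) * (sgK (ts j) (ps j) (z.1 + z.2) (z.1 - z.2) * Φ z.1 z.2) := by
    intro z
    rw [hF, sgF, sub_mul, Finset.sum_mul]
    simp_rw [mul_assoc]
  have hI : ∫ z : ℝ × ℝ, F (z.1 + z.2) (z.1 - z.2) * Φ z.1 z.2 ∂(volume.prod volume) = -(1/4) := by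
    simp_rw [hFΦ]
    rw [integral_sub (hk t p).1 (integrable_finsetSum _ (fun j _ => (hk (ts j) (ps j)).1.const_mul _)),
      hmain, integral_finsetSum _ (fun j _ => (hk (ts j) (ps j)).1.const_mul _)]
    simp_rw [integral_const_mul, hoth]
    simp
  have hI' : ENNReal.ofReal (1 / 4) ≤ ∫⁻ z : ℝ × ℝ, ENNReal.ofReal ‖F (z.1 + z.2) (z.1 - z.2) * Φ z.1 z.2‖ ∂(volume.prod volume) := by
    have := enorm_integral_le_lintegral_enorm (μ := (volume : Measure ℝ).prod volume)
      (fun z : ℝ × ℝ => F (z.1 + z.2) (z.1 - z.2) * Φ z.1 z.2)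
    rw [hI, ← ofReal_norm] at this
    simp_rw [← ofReal_norm] at this
    norm_num at this ⊢
    exact this
  set X := ∫⁻ z : ℝ × ℝ, ENNReal.ofReal (‖F (z.1 + z.2) (z.1 - z.2)‖ ^ 2 *
          (|z.1 + z.2| ^ (1 - 2 * H) * |z.1 - z.2| ^ (-γ))) ∂(volume.prod volume) with hX
  have hYr := hY r (t + p) (t - p) hr (by linarith)
  set s := 4 * (Cy * r ^ (-(2 * H + γ))) with hs
  have hsp : 0 < s := by positivity
  have hpt : ∀ᵐ z : ℝ × ℝ ∂((volume : Measure ℝ).prod volume),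
      ENNReal.ofReal 2 * ENNReal.ofReal ‖F (z.1 + z.2) (z.1 - z.2) * Φ z.1 z.2‖ ≤
      ENNReal.ofReal s * ENNReal.ofReal (‖F (z.1 + z.2) (z.1 - z.2)‖ ^ 2 *
          (|z.1 + z.2| ^ (1 - 2 * H) * |z.1 - z.2| ^ (-γ))) +
      ENNReal.ofReal s⁻¹ * ENNReal.ofReal (‖Φ z.1 z.2‖ ^ 2 *
      (|z.1 + z.2| ^ (2 * H - 1) * |z.1 - z.2| ^ γ)) := by
    filter_upwards [aux_ae] with z hz
    have ht : 0 < |z.1 + z.2| := abs_pos.2 hz.2.2.2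
    have hrho : 0 < |z.1 - z.2| := abs_pos.2 (sub_ne_zero.2 hz.2.2.1)
    set W := |z.1 + z.2| ^ (2 * H - 1) * |z.1 - z.2| ^ γ with hW
    have hWp : 0 < W := by positivity
    have hWi : |z.1 + z.2| ^ (1 - 2 * H) * |z.1 - z.2| ^ (-γ) = W⁻¹ := by
      rw [hW, mul_inv, ← Real.rpow_neg ht.le, ← Real.rpow_neg hrho.le]; congr 2; ring
    rw [hWi, ← ENNReal.ofReal_mul (by norm_num), ← ENNReal.ofReal_mul hsp.le,
      ← ENNReal.ofReal_mul (by positivity), ← ENNReal.ofReal_add (by positivity) (by positivity), norm_mul]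
    apply ENNReal.ofReal_le_ofReal
    set A := ‖F (z.1 + z.2) (z.1 - z.2)‖
    set B := ‖Φ z.1 z.2‖
    have : s * (A ^ 2 * W⁻¹) + s⁻¹ * (B ^ 2 * W) - 2 * (A * B) = (s * A - B * W) ^ 2 / (s * W) := by
      field_simp
      ring
    have h3 : 0 ≤ (s * A - B * W) ^ 2 / (s * W) := by positivity
    linarith
  have hmeas : Measurable (fun z : ℝ × ℝ => ENNReal.ofReal (‖F (z.1 + z.2) (z.1 - z.2)‖ ^ 2 *
          (|z.1 + z.2| ^ (1 - 2 * H) * |z.1 - z.2| ^ (-γ)))) := by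
    have hm : Measurable (fun z : ℝ × ℝ => F (z.1 + z.2) (z.1 - z.2)) :=
      (sgF_meas t p ts ps coef).comp (g := fun z : ℝ × ℝ => sgF t p ts ps coef z.1 z.2)
        (f := fun z : ℝ × ℝ => (z.1 + z.2, z.1 - z.2)) (by fun_prop)
    have hw : Measurable (fun z : ℝ × ℝ => |z.1 + z.2| ^ (1 - 2 * H) * |z.1 - z.2| ^ (-γ)) := by
      fun_prop
    exact ENNReal.measurable_ofReal.comp ((hm.norm.pow_const 2).mul hw)
  have hfin : ENNReal.ofReal (1 / 2) ≤ ENNReal.ofReal s * X + ENNReal.ofReal (1 / 4) := by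
    calc ENNReal.ofReal (1 / 2) = ENNReal.ofReal 2 * ENNReal.ofReal (1 / 4) := by
          rw [← ENNReal.ofReal_mul (by norm_num)]; norm_num
      _ ≤ ENNReal.ofReal 2 * ∫⁻ z : ℝ × ℝ, ENNReal.ofReal ‖F (z.1 + z.2) (z.1 - z.2) * Φ z.1 z.2‖ ∂(volume.prod volume) := by
          gcongr
      _ = ∫⁻ z : ℝ × ℝ, ENNReal.ofReal 2 * ENNReal.ofReal ‖F (z.1 + z.2) (z.1 - z.2) * Φ z.1 z.2‖ ∂(volume.prod volume) := by
          rw [lintegral_const_mul' _ _ ENNReal.ofReal_ne_top]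
      _ ≤ _ := lintegral_mono_ae hpt
      _ = ENNReal.ofReal s * X + ENNReal.ofReal s⁻¹ * ∫⁻ z : ℝ × ℝ, ENNReal.ofReal (‖Φ z.1 z.2‖ ^ 2 *
            (|z.1 + z.2| ^ (2 * H - 1) * |z.1 - z.2| ^ γ)) ∂(volume.prod volume) := by
          rw [lintegral_add_left (hmeas.const_mul _), lintegral_const_mul' _ _ ENNReal.ofReal_ne_top,
            lintegral_const_mul' _ _ ENNReal.ofReal_ne_top]
      _ ≤ ENNReal.ofReal s * X + ENNReal.ofReal s⁻¹ * ENNReal.ofReal (Cy * r ^ (-(2 * H + γ))) := by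
          gcongr
      _ = _ := by
          rw [← ENNReal.ofReal_mul (by positivity)]
          congr 2
          have : Cy * r ^ (-(2 * H + γ)) ≠ 0 := by positivity
          rw [hs]; field_simp
  have h5 : ENNReal.ofReal (1 / 4) ≤ ENNReal.ofReal s * X := by
    have : ENNReal.ofReal (1 / 2) = ENNReal.ofReal (1 / 4) + ENNReal.ofReal (1 / 4) := by
      rw [← ENNReal.ofReal_add (by norm_num) (by norm_num)]; norm_num
    rw [this] at hfin
    exact (ENNReal.add_le_add_iff_right ENNReal.ofReal_ne_top).1 hfin
  calc ENNReal.ofReal (1 / (16 * Cy) * r ^ (2 * H + γ)) = ENNReal.ofReal s⁻¹ * ENNReal.ofReal (1 / 4) := by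
        rw [← ENNReal.ofReal_mul (by positivity), hs, Real.rpow_neg hr.le]
        congr 1
        have : r ^ (2 * H + γ) ≠ 0 := by positivity
        field_simp
        norm_num
    _ ≤ ENNReal.ofReal s⁻¹ * (ENNReal.ofReal s * X) := by gcongr
    _ = X := by
        rw [← mul_assoc, ← ENNReal.ofReal_mul (by positivity), inv_mul_cancel₀ hsp.ne']
        simp

theorem even_fold (f : ℝ → ℝ → ℝ≥0∞) (hf : Measurable (Function.uncurry f))
    (he : ∀ τ ρ, f (-τ) (-ρ) = f τ ρ) :
    ∫⁻ z : ℝ × ℝ, f (z.1 + z.2) (z.1 - z.2) ∂(volume.prod volume) ≤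
      ∫⁻ ρ in Ioi (0 : ℝ), ∫⁻ τ : ℝ, f τ ρ := by
  have hm1 : Measurable (fun z : ℝ × ℝ => f (z.1 + z.2) (z.1 - z.2)) :=
    hf.comp (f := fun z : ℝ × ℝ => (z.1 + z.2, z.1 - z.2)) (by fun_prop)
  have mp := measurePreserving_add_prod (G := ℝ) (volume : Measure ℝ) (volume : Measure ℝ)
  rw [← mp.lintegral_comp hm1]
  have hm2 : Measurable (fun z : ℝ × ℝ => f (z.1 + z.2 + z.2) (z.1 + z.2 - z.2)) :=
    hf.comp (f := fun z : ℝ × ℝ => (z.1 + z.2 + z.2, z.1 + z.2 - z.2)) (by fun_prop)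
  rw [lintegral_prod _ hm2.aemeasurable]
  set h : ℝ → ℝ≥0∞ := fun ρ => ∫⁻ τ : ℝ, f τ ρ with hh
  have e1 : ∀ ρ : ℝ, ∫⁻ m : ℝ, f (ρ + m + m) (ρ + m - m) = ENNReal.ofReal (1 / 2) * h ρ := by
    intro ρ
    have hg : Measurable (fun y : ℝ => f (ρ + y) ρ) :=
      hf.comp (f := fun y : ℝ => (ρ + y, ρ)) (by fun_prop)
    have e2 : ∀ m : ℝ, f (ρ + m + m) (ρ + m - m) = (fun y : ℝ => f (ρ + y) ρ) (2 * m) := by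
      intro m; simp only []; congr 1 <;> ring
    simp_rw [e2]
    rw [← lintegral_map (f := fun y : ℝ => f (ρ + y) ρ) (g := fun m : ℝ => 2 * m) hg (by fun_prop),
      Real.map_volume_mul_left (by norm_num : (2:ℝ) ≠ 0), lintegral_smul_measure,
      lintegral_add_left_eq_self (fun y => f y ρ) ρ]
    rw [smul_eq_mul]
    congr 2
    rw [abs_of_pos (by norm_num)]; norm_num
  simp_rw [e1]
  rw [lintegral_const_mul' _ _ ENNReal.ofReal_ne_top]
  have hev : ∀ ρ, h (-ρ) = h ρ := by
    intro ρ
    simp only [hh]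
    rw [← lintegral_neg_eq_self (fun τ => f τ (-ρ))]
    simp_rw [he]
  have e3 : ∫⁻ ρ, h ρ = ∫⁻ ρ in Ioi 0, h ρ + h ρ := by
    have hhm : Measurable h := by
      have : Measurable (Function.uncurry (fun ρ τ => f τ ρ)) :=
        hf.comp (f := fun z : ℝ × ℝ => (z.2, z.1)) (by fun_prop)
      exact this.lintegral_prod_right
    rw [lintegral_add_left hhm, ← lintegral_add_compl h (measurableSet_Ioi (a := (0:ℝ)))]
    congr 1
    rw [compl_Ioi, setLIntegral_congr Iio_ae_eq_Iic.symm, ← lintegral_indicator measurableSet_Iio,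
      ← lintegral_indicator measurableSet_Ioi, ← lintegral_neg_eq_self]
    congr 1
    ext x
    by_cases hx : 0 < x
    · simp [indicator, hx, hev]
    · simp [indicator, hx]
  rw [e3]
  simp_rw [← two_mul]
  rw [lintegral_const_mul' _ _ (by simp), ← mul_assoc]
  have : ENNReal.ofReal (1 / 2) * 2 = 1 := by
    rw [← ENNReal.ofReal_ofNat, ← ENNReal.ofReal_mul (by norm_num)]; norm_num
  rw [this, one_mul]

theorem sgK_neg (t p τ ρ : ℝ) : sgK t p (-τ) (-ρ) = (starRingEnd ℂ) (sgK t p τ ρ) := by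
  have hn : ((-τ : ℝ) : ℂ) + ((-ρ : ℝ) : ℂ) = -((τ : ℂ) + ρ) := by push_cast; ring
  have hn2 : ((-τ : ℝ) : ℂ) - ((-ρ : ℝ) : ℂ) = -((τ : ℂ) - ρ) := by push_cast; ring
  have hn3 : (2 : ℂ) * ((-ρ : ℝ) : ℂ) = -(2 * (ρ : ℂ)) := by push_cast; ring
  unfold sgK
  rw [hn, hn2, hn3]
  simp only [map_mul, map_sub, map_div₀, map_add, ← Complex.exp_conj, map_neg, Complex.conj_I,
    Complex.conj_ofReal, map_ofNat]
  push_cast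
  simp only [neg_neg, mul_neg, neg_mul, div_neg]
  ring

theorem sgF_neg {n : ℕ} (t p : ℝ) (ts ps coef : Fin n → ℝ) (τ ρ : ℝ) :
    ‖sgF t p ts ps coef (-τ) (-ρ)‖ = ‖sgF t p ts ps coef τ ρ‖ := by
  have : sgF t p ts ps coef (-τ) (-ρ) = (starRingEnd ℂ) (sgF t p ts ps coef τ ρ) := by
    unfold sgF
    simp only [sgK_neg, map_sub, map_sum, map_mul, Complex.conj_ofReal]
  rw [this, RCLike.norm_conj]

theorem Gker_smul (N : ℕ) (t : ℝ) (x w : EuclideanSpace ℝ (Fin N)) (hw : ‖w‖ = 1) (τ ρ : ℝ)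
    (hρ : 0 < ρ) : Gker N t x τ (ρ • w) = sgK t (inner ℝ x w) τ ρ := by
  unfold Gker sgK
  rw [norm_smul, hw, mul_one, Real.norm_of_nonneg hρ.le, inner_smul_right]

theorem Gker_meas (N : ℕ) (t : ℝ) (x : EuclideanSpace ℝ (Fin N)) :
    Measurable (fun z : ℝ × EuclideanSpace ℝ (Fin N) => Gker N t x z.1 z.2) := by
  unfold Gker
  fun_prop

theorem polar_lint (N : ℕ) (hN : 1 ≤ N) (g : EuclideanSpace ℝ (Fin N) → ℝ≥0∞) (hg : Measurable g) :
    ∫⁻ ξ, g ξ = ∫⁻ w, (∫⁻ ρ in Ioi (0 : ℝ),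
      ENNReal.ofReal (ρ ^ (N - 1)) * g (ρ • (w : EuclideanSpace ℝ (Fin N)))) ∂(sphMeasure N) := by
  have : Nonempty (Fin N) := ⟨⟨0, hN⟩⟩
  have : Nontrivial (EuclideanSpace ℝ (Fin N)) := inferInstance
  have hfr : Module.finrank ℝ (EuclideanSpace ℝ (Fin N)) = N := by simp
  have mp := (volume : Measure (EuclideanSpace ℝ (Fin N))).measurePreserving_homeomorphUnitSphereProd
  rw [hfr] at mp
  have hG : Measurable (fun z : Metric.sphere (0 : (EuclideanSpace ℝ (Fin N))) 1 × Ioi (0 : ℝ) => g (z.2.1 • z.1.1)) := by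
    apply hg.comp; fun_prop
  calc ∫⁻ ξ, g ξ = ∫⁻ ξ : ({(0)}ᶜ : Set (EuclideanSpace ℝ (Fin N))), g ξ.1 ∂((volume : Measure (EuclideanSpace ℝ (Fin N))).comap (↑)) := by
        rw [lintegral_subtype_comap (measurableSet_singleton _).compl, restrict_compl_singleton]
    _ = ∫⁻ z, g (z.2.1 • z.1.1) ∂((volume : Measure (EuclideanSpace ℝ (Fin N))).toSphere.prod (.volumeIoiPow (N - 1))) := by
        rw [← mp.lintegral_comp hG]
        apply lintegral_congr
        intro ξ
        have := (homeomorphUnitSphereProd (EuclideanSpace ℝ (Fin N))).symm_apply_apply ξ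
        conv_lhs => rw [← this]
        rw [homeomorphUnitSphereProd_symm_apply_coe]
    _ = _ := by
        rw [lintegral_prod _ hG.aemeasurable]
        unfold sphMeasure
        apply lintegral_congr
        intro w
        have hw : Measurable (fun y : Ioi (0 : ℝ) => g (y.1 • (w : EuclideanSpace ℝ (Fin N)))) :=
          hG.comp (f := fun y => (w, y)) (by fun_prop)
        rw [Measure.volumeIoiPow]
        refine (lintegral_withDensity_eq_lintegral_mul _ (by fun_prop) hw).trans ?_
        simp only [Pi.mul_apply]
        exact lintegral_subtype_comap measurableSet_Ioi
          (fun ρ : ℝ => ENNReal.ofReal (ρ ^ (N - 1)) * g (ρ • (w : (EuclideanSpace ℝ (Fin N)))))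

theorem spec_lower (N : ℕ) (hN : 1 ≤ N) (H β : ℝ)
    (hfun : EuclideanSpace ℝ (Fin N) → ℝ) (c₁ : ℝ) (hc₁ : 0 < c₁)
    (hflow : ∀ ξ : EuclideanSpace ℝ (Fin N), ξ ≠ 0 → c₁ * ‖ξ‖ ^ (-β) ≤ hfun ξ)
    (n : ℕ) (t : ℝ) (x : EuclideanSpace ℝ (Fin N))
    (ts : Fin n → ℝ) (xs : Fin n → EuclideanSpace ℝ (Fin N)) (coef : Fin n → ℝ) :
    ENNReal.ofReal c₁ * ∫⁻ w, (∫⁻ ρ in Ioi (0 : ℝ), ∫⁻ τ : ℝ,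
      ENNReal.ofReal (‖sgF t (inner ℝ x (w : EuclideanSpace ℝ (Fin N))) ts
        (fun j => inner ℝ (xs j) (w : EuclideanSpace ℝ (Fin N))) coef τ ρ‖ ^ 2 *
          (|τ| ^ (1 - 2 * H) * |ρ| ^ (-(β - N + 1))))) ∂(sphMeasure N) ≤
      specInt N H hfun
        (fun τ ξ => Gker N t x τ ξ - ∑ j, (coef j : ℂ) * Gker N (ts j) (xs j) τ ξ) := by
  have : Nonempty (Fin N) := ⟨⟨0, hN⟩⟩
  have : Nontrivial (EuclideanSpace ℝ (Fin N)) := inferInstance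
  set F : ℝ → (EuclideanSpace ℝ (Fin N)) → ℂ := fun τ ξ => Gker N t x τ ξ - ∑ j, (coef j : ℂ) * Gker N (ts j) (xs j) τ ξ with hF
  have hFm : Measurable (fun z : ℝ × (EuclideanSpace ℝ (Fin N)) => F z.1 z.2) := by
    refine (Gker_meas N t x).sub (Finset.measurable_sum _ (fun j _ => ?_))
    exact (Gker_meas N (ts j) (xs j)).const_mul _
  set K : ℝ → (EuclideanSpace ℝ (Fin N)) → ℝ≥0∞ := fun τ ξ =>
    ENNReal.ofReal (‖F τ ξ‖ ^ 2 * (|τ| ^ (1 - 2 * H) * (c₁ * ‖ξ‖ ^ (-β)))) with hK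
  have hKm : Measurable (Function.uncurry K) := by
    have hw : Measurable (fun z : ℝ × (EuclideanSpace ℝ (Fin N)) => |z.1| ^ (1 - 2 * H) * (c₁ * ‖z.2‖ ^ (-β))) := by fun_prop
    exact ENNReal.measurable_ofReal.comp ((hFm.norm.pow_const 2).mul hw)
  have h0 : ∀ᵐ ξ : (EuclideanSpace ℝ (Fin N)), ξ ≠ 0 := by
    simp [ae_iff]
  have hKm' : Measurable (fun ξ : (EuclideanSpace ℝ (Fin N)) => ∫⁻ τ, K τ ξ) := hKm.lintegral_prod_left
  calc _ = ∫⁻ w, (∫⁻ ρ in Ioi (0 : ℝ), ENNReal.ofReal (ρ ^ (N - 1)) * ∫⁻ τ, K τ (ρ • (w : (EuclideanSpace ℝ (Fin N))))) ∂(sphMeasure N) := by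
        rw [← lintegral_const_mul' _ _ ENNReal.ofReal_ne_top]
        apply lintegral_congr
        intro w
        have hw : ‖(w : (EuclideanSpace ℝ (Fin N)))‖ = 1 := by simp
        rw [← lintegral_const_mul' _ _ ENNReal.ofReal_ne_top]
        apply setLIntegral_congr_fun measurableSet_Ioi
        intro ρ hρ
        have hρ : 0 < ρ := hρ
        beta_reduce
        rw [← lintegral_const_mul' _ _ ENNReal.ofReal_ne_top, ← lintegral_const_mul' _ _ ENNReal.ofReal_ne_top]
        apply lintegral_congr
        intro τ
        rw [hK]
        beta_reduce
        rw [← ENNReal.ofReal_mul hc₁.le, ← ENNReal.ofReal_mul (by positivity)]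
        have e1 : F τ (ρ • (w : (EuclideanSpace ℝ (Fin N)))) = sgF t (inner ℝ x (w : (EuclideanSpace ℝ (Fin N)))) ts (fun j => inner ℝ (xs j) (w : (EuclideanSpace ℝ (Fin N)))) coef τ ρ := by
          simp only [hF, sgF, Gker_smul N _ _ _ hw _ _ hρ]
        have e2 : |ρ| ^ (-(β - N + 1)) = ρ ^ (N - 1) * ρ ^ (-β) := by
          rw [abs_of_pos hρ, ← Real.rpow_natCast, ← Real.rpow_add hρ]
          congr 1
          rw [Nat.cast_sub hN]; push_cast; ring
        rw [e1, e2, norm_smul, hw, mul_one, Real.norm_of_nonneg hρ.le]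
        congr 1
        ring
    _ = ∫⁻ ξ, ∫⁻ τ, K τ ξ := (polar_lint N hN _ hKm').symm
    _ = ∫⁻ τ, ∫⁻ ξ, K τ ξ := (lintegral_lintegral_swap hKm.aemeasurable).symm
    _ ≤ _ := by
        unfold specInt
        apply lintegral_mono
        intro τ
        apply lintegral_mono_ae
        filter_upwards [h0] with ξ hξ
        rw [hK]
        apply ENNReal.ofReal_le_ofReal
        rw [← mul_assoc]
        have := hflow ξ hξ
        gcongr

/-- Proposition 3.2: strong local nondeterminism of the solution of the stochastic wave
equation with fractional-colored noise, in the form of a spherical integral. -/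
theorem spherical_strong_LND
    (N : ℕ) (hN : 1 ≤ N) (H β : ℝ) (hH1 : 1 / 2 ≤ H) (hH2 : H < 1)
    (hβ0 : 0 < β) (hβN : β < N)
    (hβlow : (N : ℝ) - 2 * H - 1 < β) (hβup : β < (N : ℝ) - 2 * H + 1)
    (hfun : EuclideanSpace ℝ (Fin N) → ℝ) (hmeas : Measurable hfun)
    (c₁ c₂ : ℝ) (hc₁ : 0 < c₁) (hc₁₂ : c₁ ≤ c₂)
    (hflow : ∀ ξ : EuclideanSpace ℝ (Fin N), ξ ≠ 0 → c₁ * ‖ξ‖ ^ (-β) ≤ hfun ξ)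
    (hfup : ∀ ξ : EuclideanSpace ℝ (Fin N), ξ ≠ 0 → hfun ξ ≤ c₂ * ‖ξ‖ ^ (-β))
    (a : ℝ) (ha : 0 < a) :
    ∃ C r₀ : ℝ, 0 < C ∧ 0 < r₀ ∧
      ∀ n : ℕ, 1 ≤ n →
        ∀ (t : ℝ) (x : EuclideanSpace ℝ (Fin N))
          (ts : Fin n → ℝ) (xs : Fin n → EuclideanSpace ℝ (Fin N)),
          a ≤ t → (∀ j, a ≤ ts j) →
          (∀ j, |t - ts j| + ‖x - xs j‖ ≤ r₀) →
          ∀ coef : Fin n → ℝ,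
            ENNReal.ofReal C *
                ∫⁻ w, ENNReal.ofReal
                  (⨅ j, |(t - ts j) +
                      (inner ℝ (x - xs j) (w : EuclideanSpace ℝ (Fin N)) : ℝ)| ^
                        (2 * H + 1 - N + β)) ∂(sphMeasure N) ≤
              specInt N H hfun
                (fun τ ξ => Gker N t x τ ξ - ∑ j, (coef j : ℂ) * Gker N (ts j) (xs j) τ ξ) := by
  obtain ⟨C, hC, hline⟩ := line_bound a H (β - N + 1) ha hH1 (by linarith) (by linarith)
  have hr0 : 0 < min a 1 / 4 := by positivity
  refine ⟨c₁ * C, min a 1 / 4, by positivity, hr0, ?_⟩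
  intro n hn t x ts xs hat hats hclose coef
  have : Nonempty (Fin n) := ⟨⟨0, hn⟩⟩
  refine le_trans ?_ (spec_lower N hN H β hfun c₁ hc₁ hflow n t x ts xs coef)
  rw [ENNReal.ofReal_mul hc₁.le, mul_assoc]
  gcongr
  rw [← lintegral_const_mul' _ _ ENNReal.ofReal_ne_top]
  apply lintegral_mono
  intro w
  have hw : ‖(w : (EuclideanSpace ℝ (Fin N)))‖ = 1 := by simp
  set D : Fin n → ℝ := fun j => |(t - ts j) + (inner ℝ (x - xs j) (w : (EuclideanSpace ℝ (Fin N))) : ℝ)| with hD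
  obtain ⟨j0, hj0⟩ := Finite.exists_min D
  have hexp : 0 < 2 * H + 1 - N + β := by linarith
  have hinf : (⨅ j, D j ^ (2 * H + 1 - N + β)) ≤ D j0 ^ (2 * H + 1 - N + β) :=
    ciInf_le (Set.finite_range _).bddBelow j0
  have hD0 : 0 ≤ D j0 := abs_nonneg _
  have hDe : ∀ j, D j = |(t - ts j) + (inner ℝ x (w : (EuclideanSpace ℝ (Fin N))) - inner ℝ (xs j) (w : (EuclideanSpace ℝ (Fin N))))| := by
    intro j
    simp only [hD, inner_sub_left]
  have hDle : ∀ j, D j ≤ min a 1 / 4 := by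
    intro j
    refine le_trans ?_ (hclose j)
    refine (abs_add_le _ _).trans ?_
    gcongr
    have := abs_real_inner_le_norm (x - xs j) (w : (EuclideanSpace ℝ (Fin N)))
    rwa [hw, mul_one] at this
  beta_reduce
  rw [← ENNReal.ofReal_mul hC.le]
  refine le_trans (ENNReal.ofReal_le_ofReal (mul_le_mul_of_nonneg_left hinf hC.le)) ?_
  rcases hD0.eq_or_lt with h | h
  · rw [← h, Real.zero_rpow hexp.ne']
    simp
  · have h1 := hline n t (inner ℝ x (w : (EuclideanSpace ℝ (Fin N)))) ts (fun j => inner ℝ (xs j) (w : (EuclideanSpace ℝ (Fin N)))) coef (D j0) hat h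
      (hDle j0) (fun j => by rw [← hDe j]; exact hj0 j) (fun j => by rw [← hDe j]; exact hDle j)
    have e : 2 * H + (β - N + 1) = 2 * H + 1 - N + β := by ring
    rw [e] at h1
    refine h1.trans ?_
    have hm := sgF_meas t (inner ℝ x (w : (EuclideanSpace ℝ (Fin N)))) ts (fun j => inner ℝ (xs j) (w : (EuclideanSpace ℝ (Fin N)))) coef
    refine even_fold (fun τ ρ => ENNReal.ofReal (‖sgF t (inner ℝ x (w : (EuclideanSpace ℝ (Fin N)))) ts
        (fun j => inner ℝ (xs j) (w : (EuclideanSpace ℝ (Fin N)))) coef τ ρ‖ ^ 2 *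
          (|τ| ^ (1 - 2 * H) * |ρ| ^ (-(β - N + 1))))) ?_ ?_
    · have hw : Measurable (fun z : ℝ × ℝ => |z.1| ^ (1 - 2 * H) * |z.2| ^ (-(β - N + 1))) := by
        fun_prop
      exact ENNReal.measurable_ofReal.comp ((hm.norm.pow_const 2).mul hw)
    · intro τ ρ
      simp only [sgF_neg, abs_neg]
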